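/- arXiv:0804.3936 — 2 statements merged into one kernel-verified Lean document; each statement's English description precedes it below -/
import Mathlib

section
/- Fix 0<p<1 and λ>0. Let f = f(z,y,t) be defined for 0<z<z₀, y in an open interval I and t in an open interval J, twice continuously differentiable in (z,y) and once in t, and suppose f solves equation (2.1) for all 0<z<z₀. Fix y ∈ I and t ∈ J and assume that, as z → 0⁺: f_t(z,y,t), f_y(z,y,t) and f_yy(z,y,t) converge to finite limits denoted f_t(0,y,t), f_y(0,y,t), f_yy(0,y,t); the weighted derivatives z^{1−p}·f_z(z,y,t) and z^{1−p}·f_zy(z,y,t) converge to finite limits; and z^{2−p}·f_zz(z,y,t) converges to a limit −A with A ≥ λ > 0. Then the boundary values satisfy the curve shortening equation f_t(0,y,t) = f_yy(0,y,t) / ( 1 + f_y(0,y,t)² ). -/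
noncomputable section

open Set

/-- Fix `0<p<1` and `λ>0`. Let `f = f(z,y,t)` be defined for `0<z<z₀`, `y` in an
open interval `I` and `t` in an open interval `J`, twice continuously
differentiable in `(z,y)` and once in `t` (with partial derivatives
`ft, fz, fy, fzz, fzy, fyy`), and suppose `f` solves the harmonic mean curvature
graph equation (2.1) for all `0<z<z₀`.  Fix `y ∈ I`, `t ∈ J` and assume that as
`z → 0⁺` the quantities `f_t, f_y, f_yy` converge to finite limits
`Ft0, Fy0, Fyy0`, the weighted derivatives `z^{1−p}·f_z` and `z^{1−p}·f_zy`
converge to finite limits, and `z^{2−p}·f_zz` converges to `−A` with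
`A ≥ λ > 0`.  Then the boundary values satisfy the curve shortening equation
`f_t(0,y,t) = f_yy(0,y,t) / (1 + f_y(0,y,t)²)`. -/
theorem boundary_moves_by_curve_shortening
    (p lam z₀ : ℝ) (I J : Set ℝ) (hI : IsOpen I) (hJ : IsOpen J)
    (hp : 0 < p) (hp1 : p < 1) (hlam : 0 < lam) (hz₀ : 0 < z₀)
    (f ft fz fy fzz fzy fyy : ℝ → ℝ → ℝ → ℝ)
    (hft : ∀ z ∈ Ioo (0:ℝ) z₀, ∀ y ∈ I, ∀ t ∈ J,
        HasDerivAt (fun s => f z y s) (ft z y t) t)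
    (hfz : ∀ z ∈ Ioo (0:ℝ) z₀, ∀ y ∈ I, ∀ t ∈ J,
        HasDerivAt (fun s => f s y t) (fz z y t) z)
    (hfy : ∀ z ∈ Ioo (0:ℝ) z₀, ∀ y ∈ I, ∀ t ∈ J,
        HasDerivAt (fun s => f z s t) (fy z y t) y)
    (hfzz : ∀ z ∈ Ioo (0:ℝ) z₀, ∀ y ∈ I, ∀ t ∈ J,
        HasDerivAt (fun s => fz s y t) (fzz z y t) z)
    (hfzy : ∀ z ∈ Ioo (0:ℝ) z₀, ∀ y ∈ I, ∀ t ∈ J,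
        HasDerivAt (fun s => fz z s t) (fzy z y t) y)
    (hfyy : ∀ z ∈ Ioo (0:ℝ) z₀, ∀ y ∈ I, ∀ t ∈ J,
        HasDerivAt (fun s => fy z s t) (fyy z y t) y)
    -- continuity of the second derivatives in (z,y) for 0 < z < z₀
    (hreg : ∀ t ∈ J, ContinuousOn
        (fun P : ℝ × ℝ => (fzz P.1 P.2 t, fzy P.1 P.2 t, fyy P.1 P.2 t))
        ((Ioo (0:ℝ) z₀) ×ˢ I))
    -- f solves equation (2.1) for 0 < z < z₀
    (hpde : ∀ z ∈ Ioo (0:ℝ) z₀, ∀ y ∈ I, ∀ t ∈ J,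
        ft z y t =
          (fzz z y t * fyy z y t - fzy z y t ^ 2) /
            ((1 + fy z y t ^ 2) * fzz z y t - 2 * fz z y t * fy z y t * fzy z y t -
              (1 + fz z y t ^ 2) * fyy z y t))
    (y t : ℝ) (hy : y ∈ I) (ht : t ∈ J)
    (Ft0 Fy0 Fyy0 Cz Czy A : ℝ)
    (hlt : Filter.Tendsto (fun z => ft z y t) (nhdsWithin 0 (Ioi 0)) (nhds Ft0))
    (hly : Filter.Tendsto (fun z => fy z y t) (nhdsWithin 0 (Ioi 0)) (nhds Fy0))
    (hlyy : Filter.Tendsto (fun z => fyy z y t) (nhdsWithin 0 (Ioi 0)) (nhds Fyy0))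
    (hlz : Filter.Tendsto (fun z => z ^ (1 - p) * fz z y t)
        (nhdsWithin 0 (Ioi 0)) (nhds Cz))
    (hlzy : Filter.Tendsto (fun z => z ^ (1 - p) * fzy z y t)
        (nhdsWithin 0 (Ioi 0)) (nhds Czy))
    (hlzz : Filter.Tendsto (fun z => z ^ (2 - p) * fzz z y t)
        (nhdsWithin 0 (Ioi 0)) (nhds (-A)))
    (hA : lam ≤ A) :
    Ft0 = Fyy0 / (1 + Fy0 ^ 2) := by
  have hcont (q : ℝ) (hq : 0 < q) :
      Filter.Tendsto (fun z : ℝ => z ^ q) (nhdsWithin 0 (Ioi 0)) (nhds 0) := by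
    have h := (Real.continuousAt_rpow_const 0 q (Or.inr hq.le)).tendsto
    rw [Real.zero_rpow hq.ne'] at h
    exact h.mono_left nhdsWithin_le_nhds
  have hzp := hcont p hp
  have hz2p := hcont (2 - p) (by linarith)
  have hnum := (hlzz.mul hlyy).sub (hzp.mul (hlzy.pow 2))
  have hden := ((((hly.pow 2).const_add 1).mul hlzz).sub
    ((((hzp.mul hlz).mul hly).mul hlzy).const_mul 2)).sub
    ((hz2p.add (hzp.mul (hlz.pow 2))).mul hlyy)
  have hA0 : A ≠ 0 := (hlam.trans_le hA).ne'
  have hFy : 1 + Fy0 ^ 2 ≠ 0 := by positivity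
  have hlim := hnum.div hden (by simp [hA0, hFy])
  have heq := tendsto_nhds_unique hlt (hlim.congr' ?_)
  · rw [heq]
    simp [mul_comm _ A, mul_div_mul_left _ _ hA0]
  · filter_upwards [Ioo_mem_nhdsGT hz₀] with z hz
    have hpow : z ^ (2 - p) = z ^ p * (z ^ (1 - p)) ^ 2 := by
      rw [← Real.rpow_mul_natCast hz.1.le, ← Real.rpow_add hz.1]
      congr 1
      push_cast
      ring
    have hne : z ^ (2 - p) ≠ 0 := (Real.rpow_pos_of_pos hz.1 _).ne'
    rw [hpde z hz y hy t ht, ← mul_div_mul_left _ _ hne]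
    dsimp only [Pi.div_apply]
    rw [hpow]
    congr 1 <;> ring
end
end

section
/- Let 0<p<1, T>0, and let a₁₁, a₁₂, a₂₂, b₁, b₂, c, φ be continuous functions on S_T := {(z,y) : z ≥ 0} × [0,T]. Suppose f°: ℝ × [0,T] → ℝ is C² in y and C¹ in t and solves f°_t(y,t) = a₂₂(0,y,t)·f°_yy(y,t) + b₂(0,y,t)·f°_y(y,t) + c(0,y,t)·f°(y,t) + φ(0,y,t), and suppose f̃: ℝ² × [0,T] → ℝ is C² in (w,y) and C¹ in t and solves, for all (w,y,t) with z := e^w and every coefficient evaluated at (z,y,t): f̃_t = a₁₁·f̃_ww + 2·a₁₂·f̃_wy + a₂₂·f̃_yy + ((2p−1)·a₁₁ + b₁)·f̃_w + (2p·a₁₂ + b₂)·f̃_y + (p·(p−1)·a₁₁ + p·b₁ + c)·f̃ + z^{−p}·[ (a₂₂(z,y,t) − a₂₂(0,y,t))·f°_yy(y,t) + (b₂(z,y,t) − b₂(0,y,t))·f°_y(y,t) + (c(z,y,t) − c(0,y,t))·f°(y,t) + φ(z,y,t) − φ(0,y,t) ]. Then the function f(z,y,t) := f°(y,t) + z^p·f̃(ln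 z, y, t) satisfies, for all z>0 and t ∈ [0,T], the degenerate equation f_t = z²·a₁₁·f_zz + 2·z·a₁₂·f_zy + a₂₂·f_yy + b₁·z·f_z + b₂·f_y + c·f + φ. -/
noncomputable section

open Set Real

/-- The space-time half-space `S_T = {(z,y) : z ≥ 0} × [0,T]`. -/
def STset (T : ℝ) : Set (ℝ × ℝ × ℝ) := {P | 0 ≤ P.1 ∧ P.2.2 ∈ Icc 0 T}

/-- The reconstruction `f(z,y,t) := f°(y,t) + z^p · f̃(ln z, y, t)`. -/
def Frec (p : ℝ) (fo : ℝ → ℝ → ℝ) (ftil : ℝ → ℝ → ℝ → ℝ) : ℝ → ℝ → ℝ → ℝ :=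
  fun z y t => fo y t + z ^ p * ftil (Real.log z) y t

/-- The logarithmic substitution: differentiating `s ^ q * g (log s)` at `z > 0`. -/
theorem hasDerivAt_rpow_mul_comp_log {g : ℝ → ℝ} {g' z : ℝ} (q : ℝ) (hz : 0 < z)
    (hg : HasDerivAt g g' (Real.log z)) :
    HasDerivAt (fun s => s ^ q * g (Real.log s))
      (z ^ (q - 1) * (q * g (Real.log z) + g')) z := by
  refine ((Real.hasDerivAt_rpow_const (Or.inl hz.ne')).mul
    (hg.comp z (Real.hasDerivAt_log hz.ne'))).congr_deriv ?_
  rw [Real.rpow_sub_one hz.ne', Function.comp_apply]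
  ring

/-- Splitting of the degenerate Cauchy problem: if `f°` solves the trace
equation and `f̃` solves the transformed uniformly parabolic equation, then
`f(z,y,t) := f°(y,t) + z^p·f̃(ln z,y,t)` solves, for `z > 0` and `t ∈ [0,T]`,
the degenerate equation
`f_t = z²·a₁₁·f_zz + 2z·a₁₂·f_zy + a₂₂·f_yy + b₁·z·f_z + b₂·f_y + c·f + φ`. -/
theorem degenerate_equation_splitting
    (p T : ℝ) (hp : 0 < p) (hp1 : p < 1) (hT : 0 < T)
    (a11 a12 a22 b1 b2 c φ : ℝ → ℝ → ℝ → ℝ)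
    (ha11 : ContinuousOn (fun P : ℝ × ℝ × ℝ => a11 P.1 P.2.1 P.2.2) (STset T))
    (ha12 : ContinuousOn (fun P : ℝ × ℝ × ℝ => a12 P.1 P.2.1 P.2.2) (STset T))
    (ha22 : ContinuousOn (fun P : ℝ × ℝ × ℝ => a22 P.1 P.2.1 P.2.2) (STset T))
    (hb1 : ContinuousOn (fun P : ℝ × ℝ × ℝ => b1 P.1 P.2.1 P.2.2) (STset T))
    (hb2 : ContinuousOn (fun P : ℝ × ℝ × ℝ => b2 P.1 P.2.1 P.2.2) (STset T))
    (hc : ContinuousOn (fun P : ℝ × ℝ × ℝ => c P.1 P.2.1 P.2.2) (STset T))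
    (hφ : ContinuousOn (fun P : ℝ × ℝ × ℝ => φ P.1 P.2.1 P.2.2) (STset T))
    -- f° : ℝ × [0,T] → ℝ, C² in y and C¹ in t, with partial derivatives foy, foyy, fot
    (fo foy foyy fot : ℝ → ℝ → ℝ)
    (hfoy : ∀ y t, t ∈ Icc 0 T → HasDerivAt (fun s => fo s t) (foy y t) y)
    (hfoyy : ∀ y t, t ∈ Icc 0 T → HasDerivAt (fun s => foy s t) (foyy y t) y)
    (hfot : ∀ y t, t ∈ Icc 0 T → HasDerivAt (fun s => fo y s) (fot y t) t)
    (hforeg : ContinuousOn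
        (fun P : ℝ × ℝ => (foy P.1 P.2, foyy P.1 P.2, fot P.1 P.2))
        (univ ×ˢ Icc 0 T))
    -- f̃ : ℝ² × [0,T] → ℝ, C² in (w,y) and C¹ in t, with partial derivatives
    (ftil ftw fty ftww ftwy ftyy ftt : ℝ → ℝ → ℝ → ℝ)
    (hftw : ∀ w y t, t ∈ Icc 0 T → HasDerivAt (fun s => ftil s y t) (ftw w y t) w)
    (hfty : ∀ w y t, t ∈ Icc 0 T → HasDerivAt (fun s => ftil w s t) (fty w y t) y)
    (hftww : ∀ w y t, t ∈ Icc 0 T → HasDerivAt (fun s => ftw s y t) (ftww w y t) w)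
    (hftwy : ∀ w y t, t ∈ Icc 0 T → HasDerivAt (fun s => ftw w s t) (ftwy w y t) y)
    (hftyy : ∀ w y t, t ∈ Icc 0 T → HasDerivAt (fun s => fty w s t) (ftyy w y t) y)
    (hftt : ∀ w y t, t ∈ Icc 0 T → HasDerivAt (fun s => ftil w y s) (ftt w y t) t)
    (hftreg : ∀ t ∈ Icc (0:ℝ) T, Continuous
        (fun W : ℝ × ℝ => (ftw W.1 W.2 t, fty W.1 W.2 t, ftww W.1 W.2 t,
          ftwy W.1 W.2 t, ftyy W.1 W.2 t)))
    -- the trace equation for f°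
    (hfoeq : ∀ y t, t ∈ Icc 0 T →
        fot y t = a22 0 y t * foyy y t + b2 0 y t * foy y t + c 0 y t * fo y t + φ 0 y t)
    -- the transformed uniformly parabolic equation for f̃ (coefficients at z = e^w)
    (hfteq : ∀ w y t, t ∈ Icc 0 T →
        ftt w y t =
          a11 (exp w) y t * ftww w y t + 2 * a12 (exp w) y t * ftwy w y t +
            a22 (exp w) y t * ftyy w y t +
            ((2 * p - 1) * a11 (exp w) y t + b1 (exp w) y t) * ftw w y t +
            (2 * p * a12 (exp w) y t + b2 (exp w) y t) * fty w y t +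
            (p * (p - 1) * a11 (exp w) y t + p * b1 (exp w) y t + c (exp w) y t) *
              ftil w y t +
            (exp w) ^ (-p) *
              ((a22 (exp w) y t - a22 0 y t) * foyy y t +
                (b2 (exp w) y t - b2 0 y t) * foy y t +
                (c (exp w) y t - c 0 y t) * fo y t + φ (exp w) y t - φ 0 y t)) :
    ∃ Ft Fz Fy Fzz Fzy Fyy : ℝ → ℝ → ℝ → ℝ,
      ∀ z y t, 0 < z → t ∈ Icc 0 T →
        HasDerivAt (fun s => Frec p fo ftil z y s) (Ft z y t) t ∧
        HasDerivAt (fun s => Frec p fo ftil s y t) (Fz z y t) z ∧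
        HasDerivAt (fun s => Frec p fo ftil z s t) (Fy z y t) y ∧
        HasDerivAt (fun s => Fz s y t) (Fzz z y t) z ∧
        HasDerivAt (fun s => Fz z s t) (Fzy z y t) y ∧
        HasDerivAt (fun s => Fy z s t) (Fyy z y t) y ∧
        Ft z y t =
          z ^ 2 * a11 z y t * Fzz z y t + 2 * z * a12 z y t * Fzy z y t +
            a22 z y t * Fyy z y t + b1 z y t * z * Fz z y t + b2 z y t * Fy z y t +
            c z y t * Frec p fo ftil z y t + φ z y t := by
  refine ⟨fun z y t => fot y t + z ^ p * ftt (Real.log z) y t,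
    fun z y t => z ^ (p - 1) * (p * ftil (Real.log z) y t + ftw (Real.log z) y t),
    fun z y t => foy y t + z ^ p * fty (Real.log z) y t,
    fun z y t => z ^ (p - 1 - 1) *
      ((p - 1) * (p * ftil (Real.log z) y t + ftw (Real.log z) y t) +
        (p * ftw (Real.log z) y t + ftww (Real.log z) y t)),
    fun z y t => z ^ (p - 1) * (p * fty (Real.log z) y t + ftwy (Real.log z) y t),
    fun z y t => foyy y t + z ^ p * ftyy (Real.log z) y t, ?_⟩
  intro z y t hz ht
  refine ⟨(hfot y t ht).add ((hftt _ y t ht).const_mul _),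
    (hasDerivAt_rpow_mul_comp_log p hz (hftw _ y t ht)).const_add _,
    (hfoy y t ht).add ((hfty _ y t ht).const_mul _),
    hasDerivAt_rpow_mul_comp_log (p - 1) hz
      (((hftw _ y t ht).const_mul p).add (hftww _ y t ht)),
    (((hfty _ y t ht).const_mul p).add (hftwy _ y t ht)).const_mul _,
    (hfoyy y t ht).add ((hftyy _ y t ht).const_mul _), ?_⟩
  have hzp : z ^ p ≠ 0 := (Real.rpow_pos_of_pos hz p).ne'
  have hz0 : z ≠ 0 := hz.ne'
  simp only [Frec]
  rw [hfoeq y t ht, hfteq _ y t ht, Real.exp_log hz, Real.rpow_neg hz.le,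
    Real.rpow_sub_one hz0, Real.rpow_sub_one hz0]
  field_simp
  ring
end
end
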